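/- Let K be any field and G a finite group. Set G̃ = (Z/2Z) × G. Then there exists a K-embedding ι : K(G) → K(G̃) such that K(G̃) is rational (purely transcendental) over the subfield ι(K(G)). -/

import Mathlib

set_option synthInstance.maxHeartbeats 1000000
set_option maxHeartbeats 1000000

noncomputable section

/-- The rational function field `K(x(g) : g ∈ G)` in variables indexed by `G`. -/
abbrev NoetherBigField (K : Type*) [Field K] (G : Type*) : Type _ :=
  FractionRing (MvPolynomial G K)

/-- The `K`-automorphism of `K(x(g) : g ∈ G)` induced by `h · x(g) = x(hg)`. -/
def noetherAut (K : Type*) [Field K] (G : Type*) [Group G] (h : G) :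
    NoetherBigField K G ≃ₐ[K] NoetherBigField K G :=
  IsFractionRing.algEquivOfAlgEquiv (MvPolynomial.renameEquiv K (Equiv.mulLeft h))

/-- The fixed field `K(G) = K(x(g) : g ∈ G)^G`, as a subfield. -/
def noetherSubfield (K : Type*) [Field K] (G : Type*) [Group G] :
    Subfield (NoetherBigField K G) where
  carrier := {x | ∀ h : G, noetherAut K G h x = x}
  mul_mem' := by intro a b ha hb h; rw [map_mul, ha h, hb h]
  one_mem' := by intro h; rw [map_one]
  add_mem' := by intro a b ha hb h; rw [map_add, ha h, hb h]
  zero_mem' := by intro h; rw [map_zero]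
  neg_mem' := by intro a ha h; rw [map_neg, ha h]
  inv_mem' := by intro a ha h; rw [map_inv₀, ha h]

/-- Noether's fixed field `K(G) = K(x(g) : g ∈ G)^G`. -/
def NoetherField (K : Type*) [Field K] (G : Type*) [Group G] : Type _ :=
  noetherSubfield K G

instance (K : Type*) [Field K] (G : Type*) [Group G] : Field (NoetherField K G) :=
  inferInstanceAs (Field (noetherSubfield K G))

theorem algebraMap_mem_noetherSubfield (K : Type*) [Field K] (G : Type*) [Group G] (c : K) :
    algebraMap K (NoetherBigField K G) c ∈ noetherSubfield K G := by
  intro h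
  exact AlgEquiv.commutes _ c

instance (K : Type*) [Field K] (G : Type*) [Group G] : Algebra K (NoetherField K G) :=
  RingHom.toAlgebra <|
    ((algebraMap K (NoetherBigField K G)).codRestrict (noetherSubfield K G).toSubring
      (algebraMap_mem_noetherSubfield K G))

/-- An extension `L/F` is rational (purely transcendental) if `L` is `F`-isomorphic to a
rational function field `F(t₁, …, tₙ)` over `F` in finitely many variables. -/
def IsRationalExtension (F L : Type*) [Field F] [Field L] [Algebra F L] : Prop :=
  ∃ n : ℕ, Nonempty (L ≃ₐ[F] FractionRing (MvPolynomial (Fin n) F))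

/-- An extension `L/F` is stably rational if the rational function field `L(y₁, …, y_r)`
is rational over `F` for some finite number `r` of indeterminates. -/
def IsStablyRationalExtension (F L : Type*) [Field F] [Field L] [Algebra F L] : Prop :=
  ∃ r : ℕ, IsRationalExtension F (FractionRing (MvPolynomial (Fin r) L))

universe u
open Module

theorem aux_rational {F E M L : Type u} [Field F] [Field E] [Field M] [Field L]
    [Algebra F E] [Algebra E L] [Algebra F L] [Algebra F M] [Algebra M L]
    [IsScalarTower F E L] [IsScalarTower F M L] (n : ℕ)
    [FiniteDimensional F E] (hE : finrank F E ≤ n) (hM : finrank M L = 2 * n)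
    (hn : 0 < n) (htr : (n : Cardinal.{u}) ≤ Algebra.trdeg F L)
    (r : Fin n → M) (i0 : Fin n) (t : L) (p : E)
    (ht : t ^ 2 - algebraMap E L p * t + algebraMap M L (r i0) = 0)
    (hgen : ∀ S : Subfield L, (∀ e, algebraMap E L e ∈ S) → (∀ i, algebraMap M L (r i) ∈ S) →
      t ∈ S → S = ⊤) : IsRationalExtension F M := by
  let A := IntermediateField.adjoin F (Set.range r)
  let E' : IntermediateField F L := (IsScalarTower.toAlgHom F E L).fieldRange
  have e : E ≃ₐ[F] E' := AlgEquiv.ofInjectiveField (IsScalarTower.toAlgHom F E L)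
  have : FiniteDimensional F E' := e.toLinearEquiv.finiteDimensional
  have hE' : finrank F E' ≤ n := by rw [← e.toLinearEquiv.finrank_eq]; exact hE
  let C : IntermediateField A L := IntermediateField.adjoin A (E' : Set L)
  have hC : Module.rank A C ≤ n := by
    refine (IntermediateField.adjoin_rank_le_of_isAlgebraic_right A E').trans ?_
    rw [← finrank_eq_rank]
    exact_mod_cast hE'
  have hmemE : ∀ e, algebraMap E L e ∈ C := fun e =>
    IntermediateField.subset_adjoin _ _ ⟨e, rfl⟩
  have hmemr : ∀ i, algebraMap M L (r i) ∈ C := fun i =>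
    C.algebraMap_mem ⟨r i, IntermediateField.subset_adjoin _ _ ⟨i, rfl⟩⟩
  have : FiniteDimensional A C := by
    rw [FiniteDimensional, ← rank_lt_aleph0_iff]
    exact hC.trans_lt (Cardinal.natCast_lt_aleph0)
  have hC' : finrank A C ≤ n := finrank_le_of_rank_le hC
  let q : Polynomial C := Polynomial.X ^ 2 - Polynomial.C ⟨_, hmemE p⟩ * Polynomial.X
    + Polynomial.C ⟨_, hmemr i0⟩
  have hqd : q.natDegree = 2 := by unfold q; compute_degree!
  have hqm : q.Monic := by unfold q; monicity!
  have hq0 : Polynomial.aeval t q = 0 := by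
    simp only [q, map_add, map_sub, map_mul, map_pow, Polynomial.aeval_X, Polynomial.aeval_C]
    exact ht
  have hint : IsIntegral C t := ⟨q, hqm, hq0⟩
  have hD : finrank C (IntermediateField.adjoin C {t}) ≤ 2 := by
    rw [IntermediateField.adjoin.finrank hint, ← hqd]
    exact Polynomial.natDegree_le_of_dvd (minpoly.dvd _ _ hq0) hqm.ne_zero
  have hDfin : FiniteDimensional C (IntermediateField.adjoin C {t}) :=
    IntermediateField.adjoin.finiteDimensional hint
  have hDtop : IntermediateField.adjoin C {t} = ⊤ := by
    have := hgen (IntermediateField.adjoin C {t}).toSubfield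
      (fun e => (IntermediateField.adjoin C {t}).algebraMap_mem ⟨_, hmemE e⟩)
      (fun i => (IntermediateField.adjoin C {t}).algebraMap_mem ⟨_, hmemr i⟩)
      (IntermediateField.mem_adjoin_simple_self _ _)
    rw [eq_top_iff]
    intro x _
    have hx : x ∈ (IntermediateField.adjoin C {t}).toSubfield := by rw [this]; trivial
    exact hx
  rw [hDtop] at hD hDfin
  rw [IntermediateField.finrank_top'] at hD
  have : FiniteDimensional C L := IntermediateField.topEquiv.toLinearEquiv.finiteDimensional
  have : FiniteDimensional A L := FiniteDimensional.trans A C L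
  have hAL : finrank A L ≤ 2 * n := by
    rw [← finrank_mul_finrank A C L, mul_comm 2]
    exact Nat.mul_le_mul hC' hD
  have : FiniteDimensional M L := FiniteDimensional.right A M L
  have : FiniteDimensional A M := FiniteDimensional.left A M L
  have hA : A = ⊤ := by
    rw [← IntermediateField.finrank_eq_one_iff_eq_top]
    rw [← finrank_mul_finrank A M L, hM] at hAL
    have : 0 < finrank A M := finrank_pos
    have : finrank A M ≤ 1 := by
      by_contra h
      nlinarith
    omega
  have halg : Algebra.IsAlgebraic (Algebra.adjoin F (Set.range r)) M := by
    refine ⟨fun x => ?_⟩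
    have hx : x ∈ A := by rw [hA]; trivial
    obtain ⟨a, ha, b, hb, rfl⟩ := IntermediateField.mem_adjoin_iff_div.1 hx
    rw [div_eq_mul_inv]
    exact (isAlgebraic_algebraMap (⟨a, ha⟩ : Algebra.adjoin F (Set.range r))).mul
      (isAlgebraic_algebraMap (⟨b, hb⟩ : Algebra.adjoin F (Set.range r))).inv
  have htrM : Algebra.trdeg F M = Algebra.trdeg F L := by
    rw [← trdeg_add_eq F M (A := L), trdeg_eq_zero (R := M) (A := L), add_zero]
  have htb : IsTranscendenceBasis F r := by
    refine Algebra.IsAlgebraic.isTranscendenceBasis_of_lift_le_trdeg_of_finite F r ?_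
    rw [htrM]
    simpa using htr
  exact ⟨n, ⟨((htb.1.aevalEquivField).trans ((IntermediateField.equivOfEq hA).trans
    IntermediateField.topEquiv)).symm⟩⟩

section conc

variable (K : Type*) [Field K] (H : Type*)

def xx (g : H) : NoetherBigField K H := algebraMap (MvPolynomial H K) _ (MvPolynomial.X g)

theorem xx_injective : Function.Injective (xx K H) :=
  (IsFractionRing.injective (MvPolynomial H K) (NoetherBigField K H)).comp
    (MvPolynomial.X_injective)

variable {K H} in
theorem big_ext {L : Type*} [Field L] [Algebra K L] {f f' : NoetherBigField K H →ₐ[K] L}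
    (h : ∀ g, f (xx K H g) = f' (xx K H g)) : f = f' := by
  have key : f.comp (IsScalarTower.toAlgHom K (MvPolynomial H K) (NoetherBigField K H)) =
      f'.comp (IsScalarTower.toAlgHom K (MvPolynomial H K) (NoetherBigField K H)) :=
    MvPolynomial.algHom_ext h
  refine AlgHom.ext fun x => ?_
  obtain ⟨a, b, hb, rfl⟩ := IsFractionRing.div_surjective (A := MvPolynomial H K) x
  rw [map_div₀, map_div₀]
  have ha := DFunLike.congr_fun key a
  have hb := DFunLike.congr_fun key b
  simp only [AlgHom.comp_apply, IsScalarTower.coe_toAlgHom'] at ha hb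
  rw [ha, hb]

theorem subfield_eq_top (S : Subfield (NoetherBigField K H))
    (hK : ∀ c, algebraMap K (NoetherBigField K H) c ∈ S) (hx : ∀ g, xx K H g ∈ S) : S = ⊤ := by
  have hp : ∀ p : MvPolynomial H K, algebraMap _ (NoetherBigField K H) p ∈ S := by
    intro p
    induction p using MvPolynomial.induction_on with
    | C a => 
      have := hK a
      rwa [IsScalarTower.algebraMap_apply K (MvPolynomial H K)] at this
    | add p q hp hq => rw [map_add]; exact S.add_mem hp hq
    | mul_X p i hp => rw [map_mul]; exact S.mul_mem hp (hx i)
  rw [eq_top_iff]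
  intro x _
  obtain ⟨a, b, hb, rfl⟩ := IsFractionRing.div_surjective (A := MvPolynomial H K) x
  exact S.div_mem (hp a) (hp b)

theorem trdeg_big [Finite H] : Algebra.trdeg K (NoetherBigField K H) = Nat.card H := by
  have : Algebra.IsAlgebraic (MvPolynomial H K) (NoetherBigField K H) :=
    IsLocalization.isAlgebraic _ (M := nonZeroDivisors (MvPolynomial H K))
  have h1 : IsTranscendenceBasis K
    (algebraMap (MvPolynomial H K) (NoetherBigField K H) ∘ MvPolynomial.X) :=
    (IsTranscendenceBasis.mvPolynomial H K).algebraMap_comp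
  have h2 := h1.lift_cardinalMk_eq_trdeg
  have h3 : Cardinal.mk H = (Nat.card H : Cardinal) := Nat.cast_card.symm
  rw [h3, Cardinal.lift_natCast] at h2
  rw [← Cardinal.lift_inj, ← h2, Cardinal.lift_natCast]

variable [Group H]

theorem noetherAut_xx (h g : H) : noetherAut K H h (xx K H g) = xx K H (h * g) := by
  simp [noetherAut, xx]

@[reducible] def bigAction : MulSemiringAction H (NoetherBigField K H) where
  smul h x := noetherAut K H h x
  one_smul x := by
    have : (noetherAut K H 1).toAlgHom = AlgHom.id K _ :=
      big_ext fun g => by simp [noetherAut_xx]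
    exact DFunLike.congr_fun this x
  mul_smul a b x := by
    have : (noetherAut K H (a * b)).toAlgHom =
      (noetherAut K H a).toAlgHom.comp (noetherAut K H b).toAlgHom :=
      big_ext fun g => by simp [noetherAut_xx, mul_assoc]
    exact DFunLike.congr_fun this x
  smul_zero h := map_zero (noetherAut K H h)
  smul_add h := map_add (noetherAut K H h)
  smul_one h := map_one (noetherAut K H h)
  smul_mul h := map_mul (noetherAut K H h)

instance : Algebra (NoetherField K H) (NoetherBigField K H) :=
  (noetherSubfield K H).subtype.toAlgebra

theorem noether_algebraMap_def (x : NoetherField K H) :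
  algebraMap (NoetherField K H) (NoetherBigField K H) x = x.1 := rfl

instance : IsScalarTower K (NoetherField K H) (NoetherBigField K H) :=
  IsScalarTower.of_algebraMap_eq fun _ => rfl

theorem noether_finrank [Finite H] :
    Module.finrank (NoetherField K H) (NoetherBigField K H) = Nat.card H ∧
    FiniteDimensional (NoetherField K H) (NoetherBigField K H) := by
  let := bigAction K H
  have hsm : ∀ (h : H) (x : NoetherBigField K H), h • x = noetherAut K H h x := fun _ _ => rfl
  have : IsGaloisGroup H (NoetherField K H) (NoetherBigField K H) :=
    { faithful := ⟨fun {a b} hab => by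
        have := hab (xx K H 1)
        rw [hsm, hsm, noetherAut_xx, noetherAut_xx] at this
        simpa using xx_injective K H this⟩
      commutes := ⟨fun h a x => by
        rw [Algebra.smul_def, Algebra.smul_def, hsm, hsm, map_mul]
        congr 1
        exact a.2 h⟩
      isInvariant := ⟨fun x hx => ⟨⟨x, hx⟩, rfl⟩⟩ }
  have h := IsGaloisGroup.card_eq_finrank H (NoetherField K H) (NoetherBigField K H)
  refine ⟨h.symm, ?_⟩
  apply FiniteDimensional.of_finrank_pos
  rw [← h]
  exact Nat.card_pos

end conc

section main

abbrev CC := Multiplicative (ZMod 2)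
abbrev sg : CC := Multiplicative.ofAdd 1

theorem sum_cc {A : Type*} [AddCommMonoid A] (f : CC → A) : ∑ c, f c = f 1 + f sg :=
  Fin.sum_univ_two (fun i : Fin 2 => f i)

theorem prod_cc {A : Type*} [CommMonoid A] (f : CC → A) : ∏ c, f c = f 1 * f sg :=
  Fin.prod_univ_two (fun i : Fin 2 => f i)

theorem cc_cases (c : CC) : c = 1 ∨ c = sg := by
  revert c; decide

variable (K : Type*) [Field K] (G : Type*) [Group G]

def yy (g : G) : NoetherBigField K (CC × G) := ∑ c, xx K (CC × G) (c, g)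

theorem yy_aeval_injective : Function.Injective
    (MvPolynomial.aeval (R := K) (yy K G) : MvPolynomial G K →ₐ[K] NoetherBigField K (CC × G)) := by
  classical
  let f : MvPolynomial G K →ₐ[K] MvPolynomial (CC × G) K :=
    MvPolynomial.aeval fun g => ∑ c, MvPolynomial.X (c, g)
  let k : MvPolynomial (CC × G) K →ₐ[K] MvPolynomial G K :=
    MvPolynomial.aeval fun z => if z.1 = 1 then MvPolynomial.X z.2 else 0
  have h1 : k.comp f = AlgHom.id K _ := by
    apply MvPolynomial.algHom_ext
    intro g
    have : sg ≠ 1 := by decide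
    simp [k, f, sum_cc, this]
  have h2 : MvPolynomial.aeval (R := K) (yy K G) =
      (IsScalarTower.toAlgHom K (MvPolynomial (CC × G) K) (NoetherBigField K (CC × G))).comp f := by
    apply MvPolynomial.algHom_ext
    intro g
    simp [f, yy, xx]
  rw [h2]
  have : Function.Injective f := fun a b hab => by
    have := congrArg k hab
    rw [← AlgHom.comp_apply, ← AlgHom.comp_apply, h1] at this
    exact this
  exact (IsFractionRing.injective (MvPolynomial (CC × G) K) (NoetherBigField K (CC × G))).comp this

def phi : NoetherBigField K G →ₐ[K] NoetherBigField K (CC × G) :=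
  IsFractionRing.liftAlgHom (yy_aeval_injective K G)

theorem phi_xx (g : G) : phi K G (xx K G g) = yy K G g := by
  simp [phi, xx]

theorem aut_yy (z : CC × G) (g : G) :
    noetherAut K (CC × G) z (yy K G g) = yy K G (z.2 * g) := by
  simp only [yy, map_sum, noetherAut_xx, Prod.mul_def]
  exact Fintype.sum_equiv (Equiv.mulLeft z.1) _ _ fun c => rfl

theorem phi_equiv (z : CC × G) (x : NoetherBigField K G) :
    phi K G (noetherAut K G z.2 x) = noetherAut K (CC × G) z (phi K G x) := by
  have : (phi K G).comp (noetherAut K G z.2).toAlgHom =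
      (noetherAut K (CC × G) z).toAlgHom.comp (phi K G) :=
    big_ext fun g => by simp [noetherAut_xx, phi_xx, aut_yy]
  exact DFunLike.congr_fun this x

def iot : NoetherField K G →ₐ[K] NoetherField K (CC × G) where
  toFun x := ⟨phi K G x.1, fun z => by rw [← phi_equiv, x.2 z.2]⟩
  map_one' := Subtype.ext (map_one (phi K G))
  map_mul' a b := Subtype.ext (map_mul (phi K G) a.1 b.1)
  map_zero' := Subtype.ext (map_zero (phi K G))
  map_add' a b := Subtype.ext (map_add (phi K G) a.1 b.1)
  commutes' c := Subtype.ext ((phi K G).commutes c)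

variable [Fintype G]

def tt (j : ℕ) (c : CC) : NoetherBigField K (CC × G) :=
  ∑ g, yy K G g ^ j * xx K (CC × G) (c, g)

theorem aut_tt (z : CC × G) (j : ℕ) (c : CC) :
    noetherAut K (CC × G) z (tt K G j c) = tt K G j (z.1 * c) := by
  simp only [tt, map_sum, map_mul, map_pow, aut_yy, noetherAut_xx, Prod.mul_def]
  exact Fintype.sum_equiv (Equiv.mulLeft z.2) _ _ fun c => rfl

def rr (j : ℕ) : NoetherBigField K (CC × G) :=
  if j = 0 then ∏ c, tt K G 0 c else ∑ c, tt K G j c * tt K G 0 c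

theorem aut_rr (z : CC × G) (j : ℕ) : noetherAut K (CC × G) z (rr K G j) = rr K G j := by
  unfold rr
  split_ifs
  · simp only [map_prod, aut_tt]
    exact Fintype.prod_equiv (Equiv.mulLeft z.1) _ _ fun c => rfl
  · simp only [map_sum, map_mul, aut_tt]
    exact Fintype.sum_equiv (Equiv.mulLeft z.1) _ _ fun c => rfl

def rrM (j : ℕ) : NoetherField K (CC × G) := ⟨rr K G j, fun z => aut_rr K G z j⟩

theorem rrM_map (j : ℕ) :
    algebraMap (NoetherField K (CC × G)) (NoetherBigField K (CC × G)) (rrM K G j) = rr K G j := rfl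

def pp (j : ℕ) : NoetherBigField K G := ∑ g, xx K G g ^ (j + 1)

theorem phi_pp (j : ℕ) : phi K G (pp K G j) = tt K G j 1 + tt K G j sg := by
  simp only [pp, tt, map_sum, map_pow, phi_xx, ← Finset.sum_add_distrib]
  refine Finset.sum_congr rfl fun g _ => ?_
  rw [← mul_add, pow_succ]
  congr 1
  rw [yy, sum_cc]

theorem tt_ne : tt K G 0 1 - tt K G 0 sg ≠ 0 := by
  classical
  let q : MvPolynomial (CC × G) K :=
    ∑ g, MvPolynomial.X (1, g) - ∑ g, MvPolynomial.X (sg, g)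
  have h1 : tt K G 0 1 - tt K G 0 sg = algebraMap _ _ q := by
    simp [tt, q, xx]
  rw [h1]
  intro h
  have hq : q = 0 := by
    apply IsFractionRing.injective (MvPolynomial (CC × G) K) (NoetherBigField K (CC × G))
    rw [h, map_zero]
  have := congrArg (MvPolynomial.eval (fun z : CC × G => if z = (1, 1) then (1 : K) else 0)) hq
  have h3 : sg ≠ 1 := by decide
  simp [q, h3] at this

theorem gen (S : Subfield (NoetherBigField K (CC × G))) (hE : ∀ e, phi K G e ∈ S)
    (hr : ∀ i < Fintype.card G, rr K G i ∈ S) (ht : tt K G 0 1 ∈ S) : S = ⊤ := by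
  classical
  have hP : ∀ j, tt K G j 1 + tt K G j sg ∈ S := fun j => by rw [← phi_pp]; exact hE _
  have hy : ∀ g, yy K G g ∈ S := fun g => by rw [← phi_xx]; exact hE _
  have htσ : tt K G 0 sg ∈ S := by
    have := S.sub_mem (hP 0) ht
    rwa [add_sub_cancel_left] at this
  have htj : ∀ j < Fintype.card G, tt K G j 1 ∈ S := by
    intro j hj
    rcases eq_or_ne j 0 with rfl | h0
    · exact ht
    have h1 := hr j hj
    rw [rr, if_neg h0, sum_cc] at h1
    have h2 : tt K G j 1 = (tt K G j 1 * tt K G 0 1 + tt K G j sg * tt K G 0 sg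
      - (tt K G j 1 + tt K G j sg) * tt K G 0 sg) / (tt K G 0 1 - tt K G 0 sg) := by
      rw [eq_div_iff (tt_ne K G)]; ring
    rw [h2]
    exact S.div_mem (S.sub_mem h1 (S.mul_mem (hP j) htσ)) (S.sub_mem ht htσ)
  have hyinj : Function.Injective (fun g => (⟨yy K G g, hy g⟩ : S)) := by
    intro a b hab
    have : yy K G a = yy K G b := congrArg Subtype.val hab
    rw [← phi_xx, ← phi_xx] at this
    exact xx_injective K G ((phi K G).injective this)
  have hx1 : ∀ g, xx K (CC × G) (1, g) ∈ S := by
    intro g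
    let b : Polynomial S := Lagrange.basis Finset.univ (fun g => (⟨yy K G g, hy g⟩ : S)) g
    have hbd : b.natDegree < Fintype.card G := by
      have : b.natDegree = Fintype.card G - 1 :=
        Polynomial.natDegree_eq_of_degree_eq_some
          (Lagrange.degree_basis (s := Finset.univ) (hyinj.injOn (s := _)) (Finset.mem_univ g))
      have := Fintype.card_pos (α := G)
      omega
    have hb : ∀ g', (∑ j ∈ Finset.range (Fintype.card G), (b.coeff j).1 * yy K G g' ^ j) =
        if g' = g then 1 else 0 := by
      intro g'
      have h1 : b.eval (⟨yy K G g', hy g'⟩ : S) = if g' = g then 1 else 0 := by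
        split_ifs with h
        · subst h
          exact Lagrange.eval_basis_self hyinj.injOn (Finset.mem_univ g')
        · exact Lagrange.eval_basis_of_ne
            (v := fun g => (⟨yy K G g, hy g⟩ : S)) (Ne.symm h) (Finset.mem_univ g')
      rw [Polynomial.eval_eq_sum_range' hbd] at h1
      have h2 := congrArg S.subtype h1
      rw [map_sum] at h2
      simp only [map_mul, map_pow, Subfield.subtype_apply] at h2
      rw [h2]
      split_ifs <;> rfl
    have : xx K (CC × G) (1, g) =
        ∑ j ∈ Finset.range (Fintype.card G), (b.coeff j).1 * tt K G j 1 := by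
      simp only [tt, Finset.mul_sum]
      rw [Finset.sum_comm]
      simp only [← mul_assoc, ← Finset.sum_mul, hb]
      simp
    rw [this]
    exact S.sum_mem fun j hj => S.mul_mem (b.coeff j).2 (htj j (Finset.mem_range.1 hj))
  apply subfield_eq_top
  · intro c
    rw [← (phi K G).commutes c]
    exact hE _
  · rintro ⟨c, g⟩
    rcases cc_cases c with rfl | rfl
    · exact hx1 g
    · have := S.sub_mem (hy g) (hx1 g)
      rwa [yy, sum_cc, add_sub_cancel_left] at this

end main

/-- For any field `K` and finite group `G`, with `G̃ = (ℤ/2ℤ) × G`, there is a `K`-embedding of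
`K(G)` into `K(G̃)` making `K(G̃)` rational over (the image of) `K(G)`. -/
theorem noether_rational_over_direct_factor_Z2
    (K : Type*) [Field K] (G : Type*) [Group G] [Finite G] :
    ∃ ι : NoetherField K G →ₐ[K] NoetherField K (Multiplicative (ZMod 2) × G),
      @IsRationalExtension (NoetherField K G)
        (NoetherField K (Multiplicative (ZMod 2) × G)) _ _
        ι.toRingHom.toAlgebra := by
  classical
  have : Fintype G := Fintype.ofFinite G
  refine ⟨iot K G, ?_⟩
  let a1 : Algebra (NoetherField K G) (NoetherField K (CC × G)) := (iot K G).toRingHom.toAlgebra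
  let a2 : Algebra (NoetherBigField K G) (NoetherBigField K (CC × G)) :=
    (phi K G).toRingHom.toAlgebra
  let a3 : Algebra (NoetherField K G) (NoetherBigField K (CC × G)) :=
    ((phi K G).toRingHom.comp (algebraMap (NoetherField K G) (NoetherBigField K G))).toAlgebra
  have s1 : IsScalarTower (NoetherField K G) (NoetherBigField K G) (NoetherBigField K (CC × G)) :=
    IsScalarTower.of_algebraMap_eq fun _ => rfl
  have s2 : IsScalarTower (NoetherField K G) (NoetherField K (CC × G))
      (NoetherBigField K (CC × G)) :=
    IsScalarTower.of_algebraMap_eq fun _ => rfl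
  have s3 : IsScalarTower K (NoetherField K G) (NoetherBigField K (CC × G)) :=
    IsScalarTower.of_algebraMap_eq fun c => ((phi K G).commutes c).symm
  obtain ⟨f1, f2⟩ := noether_finrank K G
  obtain ⟨f3, f4⟩ := noether_finrank K (CC × G)
  have hcard : Nat.card (CC × G) = 2 * Fintype.card G := by
    rw [Nat.card_prod, Nat.card_eq_fintype_card (α := G)]
    congr 1
    simp
  rw [Nat.card_eq_fintype_card] at f1
  rw [hcard] at f3
  have htr : Algebra.trdeg (NoetherField K G) (NoetherBigField K (CC × G)) = Fintype.card G := by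
    have h1 := trdeg_add_eq K (NoetherField K G) (A := NoetherBigField K G)
    have h2 := trdeg_add_eq K (NoetherField K G) (A := NoetherBigField K (CC × G))
    rw [trdeg_eq_zero (R := NoetherField K G) (A := NoetherBigField K G), add_zero,
      trdeg_big] at h1
    rw [h1, trdeg_big, hcard, Nat.card_eq_fintype_card, two_mul, Nat.cast_add] at h2
    exact Cardinal.eq_of_add_eq_add_left h2 Cardinal.natCast_lt_aleph0
  refine aux_rational (E := NoetherBigField K G) (L := NoetherBigField K (CC × G))
    (Fintype.card G) f1.le f3 Fintype.card_pos htr.ge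
    (fun i => rrM K G i) ⟨0, Fintype.card_pos⟩ (tt K G 0 1) (pp K G 0)
    ?_ ?_
  · have h1 : algebraMap (NoetherBigField K G) (NoetherBigField K (CC × G)) (pp K G 0) =
      tt K G 0 1 + tt K G 0 sg := phi_pp K G 0
    rw [h1, rrM_map]
    simp only [rr, if_true, prod_cc]
    ring
  · intro S hE hr ht
    exact gen K G S hE (fun i hi => hr ⟨i, hi⟩) ht

end
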